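/- arXiv:2106.14871 — 3 statements merged into one kernel-verified Lean document; each statement's English description precedes it below -/
import Mathlib

section
/- Let G be a group, σ : G → G a group automorphism with σ ∘ σ = id, Y a set with a transitive right G-action, τ : Y → Y with τ ∘ τ = id and τ(y · g) = τ(y) · σ(g); fix y₀ ∈ Y with stabilizer H and g₀ ∈ G with τ(y₀) = y₀ · g₀. Let z ∈ H · g₀ satisfy z · σ(z) = 1. Then there exists z' ∈ H · g₀ with z' = g⁻¹ · σ(g) for some g ∈ G if and only if there exists h ∈ H such that h · z · σ(h) · z⁻¹ = 1 and h · z = g⁻¹ · σ(g) for some g ∈ G. (In cohomological terms: H · g₀ contains a 1-coboundary if and only if the image of the composite map H¹(ℝ, _zH) → H¹(ℝ, _zG) → H¹(ℝ, G) contains the neutral element.) -/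
/-- Let z ∈ H·g₀ satisfy z·σ(z) = 1. Then H·g₀ contains a
1-coboundary z' = g⁻¹·σ(g) if and only if there is h ∈ H with
h·z·σ(h)·z⁻¹ = 1 and h·z = g⁻¹·σ(g) for some g. -/
theorem stmt5 {G : Type*} [Group G] {Y : Type*}
    (σ : G →* G) (hσ : ∀ g, σ (σ g) = g)
    (act : Y → G → Y)
    (hact1 : ∀ y, act y 1 = y)
    (hactm : ∀ y g g', act (act y g) g' = act y (g * g'))
    (htrans : ∀ y y' : Y, ∃ g : G, act y g = y')
    (τ : Y → Y) (hτ : ∀ y, τ (τ y) = y)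
    (hcompat : ∀ y g, τ (act y g) = act (τ y) (σ g))
    (y₀ : Y) (H : Set G) (hH : H = {a : G | act y₀ a = y₀})
    (g₀ : G) (hg₀ : τ y₀ = act y₀ g₀)
    (z : G) (hz : ∃ a ∈ H, z = a * g₀) (hzcoc : z * σ z = 1) :
    (∃ z' : G, (∃ a ∈ H, z' = a * g₀) ∧ ∃ g : G, z' = g⁻¹ * σ g) ↔
    (∃ h ∈ H, h * z * σ h * z⁻¹ = 1 ∧ ∃ g : G, h * z = g⁻¹ * σ g) := by
  subst hH
  obtain ⟨b, hb, hzb⟩ := hz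
  rw [Set.mem_ofPred_eq] at hb
  have hσz : σ z = z⁻¹ := eq_inv_of_mul_eq_one_right hzcoc
  constructor
  · rintro ⟨z', ⟨a, ha, rfl⟩, g, hg⟩
    rw [Set.mem_ofPred_eq] at ha
    have hz' : a * b⁻¹ * z = a * g₀ := by rw [hzb]; group
    have hb' : act y₀ b⁻¹ = y₀ := by
      conv_lhs => rw [← hb]
      rw [hactm, mul_inv_cancel, hact1]
    refine ⟨a * b⁻¹, ?_, ?_, g, hz'.trans hg⟩
    · rw [Set.mem_ofPred_eq, ← hactm, ha, hb']
    · rw [← hσz, mul_assoc, ← map_mul, hz', hg, map_mul, map_inv, hσ]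
      group
  · rintro ⟨h, hh, -, g, hg⟩
    rw [Set.mem_ofPred_eq] at hh
    refine ⟨h * z, ⟨h * b, ?_, by rw [hzb, mul_assoc]⟩, g, hg⟩
    rw [Set.mem_ofPred_eq, ← hactm, hh, hb]
end

section
/- Let Γ = {1, γ} be a group of order 2, E a group, π : E → Γ a surjective group homomorphism, and H := ker π. Suppose x₀ ∈ E satisfies π(x₀) = γ and x₀² = 1, and define f₀ : H → H by f₀(a) = x₀ · a · x₀⁻¹. Then for any a, a' ∈ H with a · f₀(a) = 1 and a' · f₀(a') = 1, the splitting elements a · x₀ and a' · x₀ are conjugate in E if and only if there exists b ∈ H with a' = b⁻¹ · a · f₀(b). Consequently, the conjugacy classes of splitting elements of E are in bijection with the Galois cohomology classes in H¹ of the real form (H, f₀). -/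
/-- For a homomorphism onto a group with at most one nontrivial element, twisted conjugacy by the
kernel on `H = ker π` matches conjugacy in `E` on the coset of `x₀`. -/
theorem isConj_mul_iff_exists_mem_ker {Γ E : Type*} [Group Γ] [Group E] {γ : Γ}
    (hγ : γ * γ = 1) (hΓ : ∀ s : Γ, s = 1 ∨ s = γ) (π : E →* Γ) {x₀ : E} (hx₀ : π x₀ = γ)
    {a : E} (ha : a ∈ π.ker) (a' : E) :
    IsConj (a * x₀) (a' * x₀) ↔ ∃ b ∈ π.ker, a' = b⁻¹ * a * (x₀ * b * x₀⁻¹) := by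
  rw [isConj_iff]
  constructor
  · rintro ⟨g, hg⟩
    have eq_of_conj : ∀ c : E, c * (a * x₀) * c⁻¹ = a' * x₀ →
        a' = c⁻¹⁻¹ * a * (x₀ * c⁻¹ * x₀⁻¹) := fun c hc => by
      rw [eq_mul_inv_of_mul_eq hc.symm]
      group
    rcases hΓ (π g) with h | h
    · exact ⟨g⁻¹, inv_mem h, eq_of_conj g hg⟩
    · refine ⟨(g * (a * x₀))⁻¹, inv_mem ?_, eq_of_conj _ ?_⟩
      · rw [MonoidHom.mem_ker] at ha ⊢
        simp [h, ha, hx₀, hγ]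
      · rw [← hg]
        group
  · rintro ⟨b, -, rfl⟩
    exact ⟨b⁻¹, by group⟩

/-- Right multiplication by an involution `x₀` turns the cocycle condition into the condition of
being an involution. -/
theorem mul_sq_eq_mul_conj {E : Type*} [Group E] {x₀ : E} (hx₀ : x₀ ^ 2 = 1) (a : E) :
    (a * x₀) ^ 2 = a * (x₀ * a * x₀⁻¹) := by
  rw [inv_eq_of_mul_eq_one_left (by rwa [← sq]), sq]
  group

/-- Cocycles in `ker π` correspond to splitting elements by right multiplication by `x₀`. -/
def cocycleEquivSplitting {Γ E : Type*} [Group Γ] [Group E] {γ : Γ} (π : E →* Γ) {x₀ : E}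
    (hx₀ : π x₀ = γ) (hx₀2 : x₀ ^ 2 = 1) :
    {a : E // a ∈ π.ker ∧ a * (x₀ * a * x₀⁻¹) = 1} ≃ {x : E // π x = γ ∧ x ^ 2 = 1} :=
  (Equiv.mulRight x₀).subtypeEquiv fun a => by
    simp [MonoidHom.mem_ker, hx₀, mul_sq_eq_mul_conj hx₀2]


/-- With π : E → Γ = {1, γ}, H := ker π, x₀ a splitting element and
f₀(a) = x₀·a·x₀⁻¹: for 1-cocycles a, a' ∈ H (i.e. a·f₀(a) = 1 = a'·f₀(a')), the
splitting elements a·x₀ and a'·x₀ are conjugate in E iff a' = b⁻¹·a·f₀(b) for some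
b ∈ H. Consequently the conjugacy classes of splitting elements of E are in
bijection with the cohomology classes in H¹ of the real form (H, f₀). -/
theorem stmt12 {Γ : Type*} [Group Γ] {E : Type*} [Group E]
    (γ : Γ) (hγ1 : γ ≠ 1) (hγ2 : γ * γ = 1) (hΓ : ∀ s : Γ, s = 1 ∨ s = γ)
    (π : E →* Γ) (hπ : Function.Surjective π)
    (x₀ : E) (hx₀ : π x₀ = γ) (hx₀2 : x₀ ^ 2 = 1) :
    (∀ a a' : E, a ∈ π.ker → a' ∈ π.ker →
      a * (x₀ * a * x₀⁻¹) = 1 → a' * (x₀ * a' * x₀⁻¹) = 1 →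
      (IsConj (a * x₀) (a' * x₀) ↔ ∃ b ∈ π.ker, a' = b⁻¹ * a * (x₀ * b * x₀⁻¹))) ∧
    Nonempty
      (Quot (fun a a' : {a : E // a ∈ π.ker ∧ a * (x₀ * a * x₀⁻¹) = 1} =>
          ∃ b ∈ π.ker, a'.1 = b⁻¹ * a.1 * (x₀ * b * x₀⁻¹)) ≃
        Quot (fun x x' : {x : E // π x = γ ∧ x ^ 2 = 1} => IsConj x.1 x'.1)) := by
  have key : ∀ a a' : E, a ∈ π.ker →
      (IsConj (a * x₀) (a' * x₀) ↔ ∃ b ∈ π.ker, a' = b⁻¹ * a * (x₀ * b * x₀⁻¹)) :=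
    fun a a' ha => isConj_mul_iff_exists_mem_ker hγ2 hΓ π hx₀ ha a'
  exact ⟨fun a a' ha _ _ _ => key a a' ha,
    ⟨Quot.congr (cocycleEquivSplitting π hx₀ hx₀2) fun a a' => (key a.1 a'.1 a.2.1).symm⟩⟩
end

section
/- Let Γ = {1, γ} be a group of order 2, E a group, π : E → Γ a surjective group homomorphism, and H := ker π. Suppose H is abelian and the squaring map a ↦ a² is a bijection of H onto itself (H is uniquely 2-divisible). Then there exists a splitting element of E, i.e. an x₀ ∈ E with π(x₀) = γ and x₀² = 1; moreover, any two splitting elements of E are conjugate in E. -/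
/-- Let π : E → Γ = {1, γ} be surjective with kernel H. If H is
abelian and squaring is a bijection of H onto itself, then E has a splitting
element (x₀ with π(x₀) = γ and x₀² = 1), and any two splitting elements of E are
conjugate in E. -/
theorem stmt14 {Γ : Type*} [Group Γ] {E : Type*} [Group E]
    (γ : Γ) (hγ1 : γ ≠ 1) (hγ2 : γ * γ = 1) (hΓ : ∀ s : Γ, s = 1 ∨ s = γ)
    (π : E →* Γ) (hπ : Function.Surjective π)
    (hab : ∀ a ∈ π.ker, ∀ b ∈ π.ker, a * b = b * a)
    (hsq : Set.BijOn (fun a : E => a ^ 2) (π.ker : Set E) (π.ker : Set E)) :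
    (∃ x₀ : E, π x₀ = γ ∧ x₀ ^ 2 = 1) ∧
    (∀ x x' : E, π x = γ → x ^ 2 = 1 → π x' = γ → x' ^ 2 = 1 → IsConj x x') := by
  have conj_mem : ∀ x : E, ∀ a ∈ π.ker, x * a * x⁻¹ ∈ π.ker := fun x a ha =>
    (MonoidHom.normal_ker π).conj_mem a ha x
  refine ⟨?_, fun x x' hx hx2 hx' hx2' => ?_⟩
  · obtain ⟨x, hx⟩ := hπ γ
    have hx2 : x ^ 2 ∈ π.ker := by rw [MonoidHom.mem_ker, map_pow, hx, pow_two, hγ2]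
    obtain ⟨r, hr, hrx⟩ := hsq.surjOn hx2
    replace hr : r ∈ π.ker := hr
    replace hrx : r ^ 2 = x ^ 2 := hrx
    have hconj : x * r * x⁻¹ = r := by
      refine hsq.injOn (conj_mem x r hr) hr ?_
      rw [conj_pow, hrx]
      group
    have hcomm : Commute x r := mul_inv_eq_iff_eq_mul.mp hconj
    refine ⟨x * r⁻¹, ?_, ?_⟩
    · rw [map_mul, map_inv, MonoidHom.mem_ker.mp hr, hx, inv_one, mul_one]
    · rw [hcomm.inv_right.mul_pow, inv_pow, hrx, mul_inv_cancel]
  · have ha : x' * x⁻¹ ∈ π.ker := by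
      rw [MonoidHom.mem_ker, map_mul, map_inv, hx, hx', mul_inv_cancel]
    obtain ⟨b, hb, hba⟩ := hsq.surjOn ha
    replace hb : b ∈ π.ker := hb
    replace hba : b ^ 2 = x' * x⁻¹ := hba
    have hxi : x⁻¹ = x := inv_eq_of_mul_eq_one_left (by rw [← pow_two, hx2])
    have hxi' : x'⁻¹ = x' := inv_eq_of_mul_eq_one_left (by rw [← pow_two, hx2'])
    have hconj : x * b * x⁻¹ = b⁻¹ := by
      refine hsq.injOn (conj_mem x b hb) (inv_mem hb) ?_
      rw [conj_pow, inv_pow, hba, mul_inv_rev, inv_inv, hxi', mul_assoc, mul_assoc, hxi,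
        ← pow_two x, hx2, mul_one]
    refine isConj_iff.mpr ⟨b, ?_⟩
    have hxb : x * b⁻¹ = b * x := by
      rw [← mul_inv_eq_iff_eq_mul, ← conj_inv, hconj, inv_inv]
    rw [mul_assoc, hxb, ← mul_assoc, ← pow_two, hba, inv_mul_cancel_right]
end
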